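/- Let 1 < p < ∞ and λ < 0, and set K = (−λ/(p−1))^{1/p}. Suppose r : [0,π_p] → ℝ is continuous and the boundary value problem (|u′|^{p−2}u′)′ + (λ + r(x))|u|^{p−2}u = 0 on (0,π_p), u(0) = u(π_p) = 0, has a nontrivial solution. Then ∫₀^{π_p} r_+(x) dx > 2·K^{p−1}·(coth_p(K·π_p/2))^{p−1}. -/

import Mathlib

/-- The generalized π: `π_p = 2 ∫₀¹ (1 - tᵖ)^(-1/p) dt`. -/
noncomputable def piP (p : ℝ) : ℝ := 2 * ∫ t in (0:ℝ)..1, (1 - t ^ p) ^ (-(1 / p))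

/-- `arcsinh_p x = ∫₀ˣ (1 + tᵖ)^(-1/p) dt`. -/
noncomputable def arcsinhP (p x : ℝ) : ℝ := ∫ t in (0:ℝ)..x, (1 + t ^ p) ^ (-(1 / p))

/-- `sinh_p : [0,∞) → [0,∞)`, defined as the inverse of `arcsinh_p` on `[0,∞)`. -/
noncomputable def sinhP (p : ℝ) : ℝ → ℝ := Function.invFunOn (arcsinhP p) (Set.Ici 0)

/-- `cosh_p x = (1 + sinh_p x ^ p)^(1/p)`. -/
noncomputable def coshP (p x : ℝ) : ℝ := (1 + sinhP p x ^ p) ^ (1 / p)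

/-- `coth_p x = cosh_p x / sinh_p x`. -/
noncomputable def cothP (p x : ℝ) : ℝ := coshP p x / sinhP p x

/-- `u` (with continuous derivative `u'` on `[0, π_p]`) is a nontrivial solution of
`(|u'|^(p-2) u')' + (λ + r x) |u|^(p-2) u = 0` on `(0, π_p)` with `u 0 = u π_p = 0`. -/
def IsNontrivialSolution (p lam : ℝ) (r u u' : ℝ → ℝ) : Prop :=
  (∃ x ∈ Set.Icc (0:ℝ) (piP p), u x ≠ 0) ∧
  ContinuousOn u' (Set.Icc 0 (piP p)) ∧
  (∀ x ∈ Set.Icc (0:ℝ) (piP p), HasDerivWithinAt u (u' x) (Set.Icc 0 (piP p)) x) ∧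
  u 0 = 0 ∧ u (piP p) = 0 ∧
  ∀ x ∈ Set.Ioo (0:ℝ) (piP p),
    HasDerivAt (fun y => |u' y| ^ (p - 2) * u' y)
      (-((lam + r x) * |u x| ^ (p - 2) * u x)) x


theorem cont_phi (p : ℝ) (hp : 1 < p) : Continuous (fun x : ℝ => |x| ^ (p - 2) * x) := by
  rw [continuous_iff_continuousAt]
  intro x
  by_cases hx : x = 0
  · subst hx
    rw [ContinuousAt]
    simp only [mul_zero]
    rw [tendsto_zero_iff_abs_tendsto_zero]
    have h2 : Filter.Tendsto (fun x : ℝ => |x| ^ (p - 1)) (nhds 0) (nhds 0) := by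
      have : Continuous (fun x : ℝ => |x| ^ (p - 1)) :=
        continuous_abs.rpow_const (fun _ => Or.inr (by linarith))
      have h3 := this.tendsto 0
      simpa [Real.zero_rpow (by linarith : p - 1 ≠ 0)] using h3
    refine squeeze_zero (fun _ => abs_nonneg _) (fun x => ?_) h2
    simp only [Function.comp]
    rw [abs_mul, abs_of_nonneg (Real.rpow_nonneg (abs_nonneg x) _)]
    rcases eq_or_ne x 0 with rfl | h0
    · simp [Real.rpow_nonneg]
    · rw [← Real.rpow_add_one (abs_ne_zero.mpr h0)]
      apply le_of_eq; congr 1; ring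
  · exact ((continuousAt_id.abs).rpow_const (Or.inl (abs_ne_zero.mpr hx))).mul continuousAt_id

theorem phi_mul (p : ℝ) (hp : 1 < p) (x : ℝ) : |x| ^ (p - 2) * x * x = |x| ^ p := by
  rcases eq_or_ne x 0 with rfl | h0
  · simp [Real.zero_rpow (by linarith : p ≠ 0)]
  · rw [mul_assoc, ← abs_mul_abs_self, ← mul_assoc, ← Real.rpow_add_one (abs_ne_zero.mpr h0),
      ← Real.rpow_add_one (abs_ne_zero.mpr h0)]
    congr 1; ring

theorem phi_abs_rpow (p : ℝ) (hp : 1 < p) (x : ℝ) :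
    |(|x| ^ (p - 2) * x)| ^ (p / (p - 1)) = |x| ^ p := by
  have hp1 : 0 < p - 1 := by linarith
  rcases eq_or_ne x 0 with rfl | h0
  · simp [Real.zero_rpow (by linarith : p ≠ 0), Real.zero_rpow (by positivity : p / (p - 1) ≠ 0)]
  · rw [abs_mul, abs_of_nonneg (Real.rpow_nonneg (abs_nonneg x) _),
      ← Real.rpow_add_one (abs_ne_zero.mpr h0), ← Real.rpow_mul (abs_nonneg _)]
    congr 1; field_simp; ring

theorem half_ineq (p mu c : ℝ) (hp : 1 < p) (hc : 0 < c)
    (w r rho u u' : ℝ → ℝ)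
    (hw0 : ∀ x, 0 < x → 0 < w x)
    (hwd : ∀ x, 0 < x → HasDerivAt w (mu - (p - 1) * w x ^ (p / (p - 1))) x)
    (C : ℝ) (hwC : ∀ x, 0 < x → x ≤ c → w x * x ^ (p - 1) ≤ C)
    (hrho : Continuous rho) (hrho0 : ∀ x, 0 ≤ rho x)
    (hr : ∀ x ∈ Set.Ioo 0 c, r x ≤ rho x)
    (hu'c : ContinuousOn u' (Set.Icc 0 c))
    (hu : ∀ x ∈ Set.Icc (0:ℝ) c, HasDerivWithinAt u (u' x) (Set.Icc 0 c) x)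
    (hu0 : u 0 = 0) (huc : u c ≠ 0) (hu'0 : u' c = 0)
    (hmax : ∀ x ∈ Set.Icc (0:ℝ) c, |u x| ≤ |u c|)
    (heq : ∀ x ∈ Set.Ioo (0:ℝ) c, HasDerivAt (fun y => |u' y| ^ (p - 2) * u' y)
      (-((-mu + r x) * |u x| ^ (p - 2) * u x)) x) :
    w c < ∫ x in (0:ℝ)..c, rho x := by
  have hp1 : 0 < p - 1 := by linarith
  have hpp : 0 < p := by linarith
  set q := p / (p - 1) with hq
  have hpq : p.HolderConjugate q := by
    rw [Real.holderConjugate_iff]; refine ⟨hp, ?_⟩; rw [hq]; field_simp; ring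
  set M := |u c| with hM
  have hMp : 0 < M := abs_pos.mpr huc
  have hucont : ContinuousOn u (Set.Icc 0 c) := fun x hx => (hu x hx).continuousWithinAt
  -- bracket
  let H : ℝ → ℝ := fun x => |u' x| ^ p + (p - 1) * (w x ^ q * |u x| ^ p)
    - p * (u' x * (w x * (|u x| ^ (p - 2) * u x)))
  have hH0 : ∀ x, 0 < x → 0 ≤ H x := by
    intro x hx
    have hY := Real.young_inequality (u' x) (w x * (|u x| ^ (p - 2) * u x)) hpq
    rw [abs_mul (w x), Real.mul_rpow (abs_nonneg _) (abs_nonneg _), hq, phi_abs_rpow p hp, ← hq,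
      abs_of_pos (hw0 x hx)] at hY
    have h2 := mul_le_mul_of_nonneg_left hY hpp.le
    have h3 : p * (|u' x| ^ p / p + w x ^ q * |u x| ^ p / q)
      = |u' x| ^ p + (p - 1) * (w x ^ q * |u x| ^ p) := by
      have : q ≠ 0 := hpq.symm.ne_zero
      rw [hq]; field_simp
    show 0 ≤ |u' x| ^ p + (p - 1) * (w x ^ q * |u x| ^ p)
      - p * (u' x * (w x * (|u x| ^ (p - 2) * u x)))
    linarith
  have hHc : 0 < H c := by
    have : H c = (p - 1) * (w c ^ q * M ^ p) := by
      simp [H, hu'0, Real.zero_rpow hpp.ne', hM]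
    rw [this]
    have := hw0 c hc
    positivity
  have hccmem : c ∈ Set.Icc 0 c := ⟨hc.le, le_rfl⟩
  have hHcont : ContinuousWithinAt H (Set.Icc 0 c) c := by
    have h1 := hu'c c hccmem
    have h2 := hucont c hccmem
    have h3 : ContinuousWithinAt w (Set.Icc 0 c) c := (hwd c hc).continuousAt.continuousWithinAt
    have h4 : ContinuousWithinAt (fun x => |u x| ^ (p - 2) * u x) (Set.Icc 0 c) c :=
      ((cont_phi p hp).continuousAt (x := u c)).comp_continuousWithinAt h2
    refine ((h1.abs.rpow_const (Or.inr hpp.le)).add (continuousWithinAt_const.mul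
      ((h3.rpow_const (Or.inl (hw0 c hc).ne')).mul (h2.abs.rpow_const (Or.inr hpp.le))))).sub
      (continuousWithinAt_const.mul (h1.mul (h3.mul h4)))
  obtain ⟨d, hd0, hdc, hd⟩ : ∃ d, 0 < d ∧ d < c ∧ ∀ x ∈ Set.Ioo d c, 0 < H x := by
    have h1 : ∀ᶠ x in nhdsWithin c (Set.Icc 0 c), 0 < H x := hHcont.eventually_const_lt hHc
    rw [nhdsWithin_Icc_eq_nhdsLE hc] at h1
    obtain ⟨l, hl, hl2⟩ := (mem_nhdsLE_iff_exists_Ioc_subset).1 h1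
    refine ⟨max l (c / 2), by positivity, max_lt hl (by linarith), fun x hx => ?_⟩
    exact hl2 ⟨lt_of_le_of_lt (le_max_left _ _) hx.1, hx.2.le⟩
  let G : ℝ → ℝ := fun x => |u' x| ^ (p - 2) * u' x * u x + M ^ p * (∫ t in (0:ℝ)..x, rho t)
    - w x * |u x| ^ p
  have hGd : ∀ x ∈ Set.Ioo 0 c, HasDerivAt G (M ^ p * rho x - r x * |u x| ^ p + H x) x := by
    intro x hx
    have h1 : HasDerivAt u (u' x) x := (hu x ⟨hx.1.le, hx.2.le⟩).hasDerivAt (Icc_mem_nhds hx.1 hx.2)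
    have h2 : HasDerivAt (fun y => |u y| ^ p) (p * |u x| ^ (p - 2) * u x * u' x) x :=
      (hasDerivAt_abs_rpow (u x) hp).comp x h1
    have h3 : HasDerivAt (fun x => ∫ t in (0:ℝ)..x, rho t) (rho x) x :=
      (hrho.integral_hasStrictDerivAt 0 x).hasDerivAt
    have h4 := (((heq x hx).mul h1).add (h3.const_mul (M ^ p))).sub ((hwd x hx.1).mul h2)
    refine h4.congr_deriv ?_
    have e1 := phi_mul p hp (u x)
    have e2 := phi_mul p hp (u' x)
    simp only [H]
    rw [e2]
    linear_combination (mu - r x) * e1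
  have hnn : ∀ x ∈ Set.Ioo 0 c, 0 ≤ M ^ p * rho x - r x * |u x| ^ p := by
    intro x hx
    have h1 : |u x| ^ p ≤ M ^ p :=
      Real.rpow_le_rpow (abs_nonneg _) (hmax x ⟨hx.1.le, hx.2.le⟩) hpp.le
    have h2 : 0 ≤ |u x| ^ p := Real.rpow_nonneg (abs_nonneg _) _
    have h3 := mul_le_mul_of_nonneg_right (hr x hx) h2
    have h4 := mul_le_mul_of_nonneg_left h1 (hrho0 x)
    linarith
  have hGc : ContinuousOn G (Set.Icc 0 c) := by
    have h1 : ContinuousOn (fun x => |u' x| ^ (p - 2) * u' x) (Set.Icc 0 c) :=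
      (cont_phi p hp).comp_continuousOn hu'c
    have h3 : Continuous (fun x => ∫ t in (0:ℝ)..x, rho t) :=
      continuous_iff_continuousAt.2 fun x => (hrho.integral_hasStrictDerivAt 0 x).hasDerivAt.continuousAt
    refine ((h1.mul hucont).add (h3.continuousOn.const_mul (M ^ p) |>.mono (Set.subset_univ _))).sub ?_
    intro x hx
    rcases hx.1.eq_or_lt with h0 | h0
    · subst h0
      obtain ⟨B, hB⟩ := isCompact_Icc.exists_bound_of_continuousOn hu'c
      have hB0 : 0 ≤ B := (norm_nonneg _).trans (hB 0 hx)
      have hlip : ∀ x ∈ Set.Icc 0 c, |u x| ≤ B * x := by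
        intro y hy
        have := (convex_Icc 0 c).norm_image_sub_le_of_norm_hasDerivWithin_le hu hB hx hy
        simpa [hu0, abs_of_nonneg hy.1] using this
      have hz : w 0 * |u 0| ^ p = 0 := by simp [hu0, Real.zero_rpow hpp.ne']
      show Filter.Tendsto (fun x => w x * |u x| ^ p) _ (nhds (w 0 * |u 0| ^ p))
      rw [hz]
      have hlim : Filter.Tendsto (fun x : ℝ => B ^ p * C * x) (nhdsWithin 0 (Set.Icc 0 c)) (nhds 0) := by
        have : Continuous (fun x : ℝ => B ^ p * C * x) := by fun_prop
        have := this.tendsto 0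
        simp only [mul_zero] at this
        exact this.mono_left nhdsWithin_le_nhds
      refine squeeze_zero' ?_ ?_ hlim
      · filter_upwards [self_mem_nhdsWithin] with y hy
        rcases hy.1.eq_or_lt with h | h
        · rw [← h, hz]
        · have := hw0 y h; positivity
      · filter_upwards [self_mem_nhdsWithin] with y hy
        rcases hy.1.eq_or_lt with h | h
        · rw [← h, hz]; simp
        · have hwy := hw0 y h
          calc w y * |u y| ^ p ≤ w y * (B * y) ^ p := by
                gcongr; exact hlip y hy
            _ = B ^ p * (w y * y ^ (p - 1)) * y := by
                rw [Real.mul_rpow hB0 h.le]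
                have : y ^ p = y ^ (p - 1) * y := by
                  rw [← Real.rpow_add_one h.ne']; congr 1; ring
                rw [this]; ring
            _ ≤ B ^ p * C * y := by
                gcongr; exact hwC y h hy.2
    · exact ((hwd x h0).continuousAt.continuousWithinAt).mul
        ((hucont x hx).abs.rpow_const (Or.inr hpp.le))
  have hmono : MonotoneOn G (Set.Icc 0 c) := by
    refine monotoneOn_of_deriv_nonneg (convex_Icc 0 c) hGc ?_ ?_
    · rw [interior_Icc]; exact fun x hx => (hGd x hx).differentiableAt.differentiableWithinAt
    · rw [interior_Icc]; intro x hx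
      rw [(hGd x hx).deriv]
      exact add_nonneg (hnn x hx) (hH0 x hx.1)
  have hsmono : StrictMonoOn G (Set.Icc d c) := by
    refine strictMonoOn_of_deriv_pos (convex_Icc d c) (hGc.mono (Set.Icc_subset_Icc_left hd0.le)) ?_
    rw [interior_Icc]; intro x hx
    have hx' : x ∈ Set.Ioo 0 c := ⟨hd0.trans hx.1, hx.2⟩
    rw [(hGd x hx').deriv]
    exact add_pos_of_nonneg_of_pos (hnn x hx') (hd x hx)
  have hfin : G 0 < G c :=
    (hmono ⟨le_rfl, hc.le⟩ ⟨hd0.le, hdc.le⟩ hd0.le).trans_lt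
      (hsmono ⟨le_rfl, hdc.le⟩ ⟨hdc.le, le_rfl⟩ hdc)
  simp only [G, hu0, hu'0, abs_zero, Real.zero_rpow hpp.ne', intervalIntegral.integral_same] at hfin
  have hMpp : 0 < M ^ p := by positivity
  have : M ^ p * w c < M ^ p * ∫ t in (0:ℝ)..c, rho t := by
    rw [← hM] at hfin
    linarith
  exact lt_of_mul_lt_mul_left this hMpp.le

noncomputable def arcInt (p t : ℝ) : ℝ := (1 + |t| ^ p) ^ (-(1 / p))

theorem arcInt_cont (p : ℝ) (hp : 1 < p) : Continuous (arcInt p) := by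
  have h1 : Continuous (fun t : ℝ => 1 + |t| ^ p) :=
    continuous_const.add (continuous_abs.rpow_const (fun _ => Or.inr (by linarith)))
  exact h1.rpow_const (fun x => Or.inl (by positivity))

theorem arcsinhP_eq (p x : ℝ) (hx : 0 ≤ x) : arcsinhP p x = ∫ t in (0:ℝ)..x, arcInt p t := by
  unfold arcsinhP
  apply intervalIntegral.integral_congr
  intro t ht
  rw [Set.uIcc_of_le hx] at ht
  simp only [arcInt, abs_of_nonneg ht.1]

theorem arcInt_pos (p t : ℝ) : 0 < arcInt p t := by
  unfold arcInt; positivity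

theorem arcInt_le (p t : ℝ) (hp : 1 < p) : arcInt p t ≤ 1 := by
  unfold arcInt
  apply Real.rpow_le_one_of_one_le_of_nonpos
  · have : 0 ≤ |t| ^ p := by positivity
    linarith
  · have : 0 < 1 / p := by positivity
    linarith

theorem arcInt_ge (p t : ℝ) (hp : 1 < p) (ht : 0 ≤ t) : (1 + t)⁻¹ ≤ arcInt p t := by
  unfold arcInt
  have hpp : 0 < p := by linarith
  rw [abs_of_nonneg ht, Real.rpow_neg (by positivity)]
  apply inv_anti₀ (by positivity)
  have h := Real.add_rpow_le_rpow_add zero_le_one ht hp.le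
  rw [Real.one_rpow] at h
  calc (1 + t ^ p) ^ (1 / p) ≤ ((1 + t) ^ p) ^ (1 / p) := by gcongr
    _ = 1 + t := by
      rw [← Real.rpow_mul (by positivity), mul_one_div_cancel hpp.ne', Real.rpow_one]

/-- smooth version of arcsinhP -/
noncomputable def asP (p x : ℝ) : ℝ := ∫ t in (0:ℝ)..x, arcInt p t

theorem asP_deriv (p x : ℝ) (hp : 1 < p) : HasDerivAt (asP p) (arcInt p x) x :=
  ((arcInt_cont p hp).integral_hasStrictDerivAt 0 x).hasDerivAt

theorem asP_strictMono (p : ℝ) (hp : 1 < p) : StrictMono (asP p) :=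
  strictMono_of_deriv_pos (fun x => by rw [(asP_deriv p x hp).deriv]; exact arcInt_pos p x)

theorem asP_zero (p : ℝ) : asP p 0 = 0 := by simp [asP]

theorem asP_le (p x : ℝ) (hp : 1 < p) (hx : 0 ≤ x) : asP p x ≤ x := by
  have := intervalIntegral.integral_mono_on hx ((arcInt_cont p hp).intervalIntegrable 0 x)
    (continuous_const.intervalIntegrable (μ := MeasureTheory.volume) 0 x) (fun t _ => arcInt_le p t hp)
  simpa [asP] using this

theorem asP_ge (p x : ℝ) (hp : 1 < p) (hx : 0 ≤ x) : Real.log (1 + x) ≤ asP p x := by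
  have hint : ∫ t in (0:ℝ)..x, (1 + t)⁻¹ = Real.log (1 + x) := by
    rw [intervalIntegral.integral_comp_add_left (fun t => t⁻¹) 1, integral_inv]
    · simp
    · rw [Set.uIcc_of_le (by linarith)]; intro h; have := h.1; linarith
  rw [← hint]
  refine intervalIntegral.integral_mono_on hx ?_ ((arcInt_cont p hp).intervalIntegrable 0 x)
    (fun t ht => arcInt_ge p t hp ht.1)
  apply ContinuousOn.intervalIntegrable
  rw [Set.uIcc_of_le hx]
  apply ContinuousOn.inv₀ (by fun_prop)
  intro t ht; have := ht.1; positivity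

theorem asP_surj (p y : ℝ) (hp : 1 < p) (hy : 0 ≤ y) : ∃ x ∈ Set.Ici (0:ℝ), arcsinhP p x = y := by
  have hX : 0 ≤ Real.exp y - 1 := by have := Real.add_one_le_exp y; linarith
  have hc : ContinuousOn (asP p) (Set.Icc 0 (Real.exp y - 1)) :=
    fun x _ => (asP_deriv p x hp).continuousAt.continuousWithinAt
  have h2 : y ≤ asP p (Real.exp y - 1) := by
    have := asP_ge p _ hp hX
    simpa using this
  obtain ⟨x, hx, hxy⟩ := intermediate_value_Icc hX hc ⟨by rw [asP_zero]; exact hy, h2⟩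
  exact ⟨x, hx.1, by rw [arcsinhP_eq p x hx.1]; exact hxy⟩

theorem sinhP_spec (p y : ℝ) (hp : 1 < p) (hy : 0 ≤ y) :
    0 ≤ sinhP p y ∧ asP p (sinhP p y) = y := by
  have h := Function.invFunOn_pos (asP_surj p y hp hy)
  have h1 : 0 ≤ sinhP p y := h.1
  exact ⟨h1, by have := h.2; rw [arcsinhP_eq p _ h.1] at this; exact this⟩

theorem sinhP_ge (p y : ℝ) (hp : 1 < p) (hy : 0 ≤ y) : y ≤ sinhP p y := by
  obtain ⟨h1, h2⟩ := sinhP_spec p y hp hy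
  have := asP_le p _ hp h1
  linarith

theorem sinhP_deriv (p y : ℝ) (hp : 1 < p) (hy : 0 < y) :
    HasDerivAt (sinhP p) ((1 + sinhP p y ^ p) ^ (1 / p)) y := by
  have hmono : StrictMonoOn (sinhP p) (Set.Ioi 0) := by
    intro a ha b hb hab
    rw [← (asP_strictMono p hp).lt_iff_lt, (sinhP_spec p a hp (le_of_lt ha)).2,
      (sinhP_spec p b hp (le_of_lt hb)).2]
    exact hab
  have hpos : 0 < sinhP p y := hy.trans_le (sinhP_ge p y hp hy.le)
  have himg : Set.Ioi 0 ⊆ sinhP p '' Set.Ioi 0 := by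
    intro s hs
    have h0 : 0 < asP p s := by rw [← asP_zero p]; exact asP_strictMono p hp hs
    exact ⟨asP p s, h0, (asP_strictMono p hp).injective (sinhP_spec p _ hp h0.le).2⟩
  have hcont : ContinuousAt (sinhP p) y :=
    hmono.continuousAt_of_image_mem_nhds (Ioi_mem_nhds hy)
      (Filter.mem_of_superset (Ioi_mem_nhds hpos) himg)
  have := HasDerivAt.of_local_left_inverse hcont (asP_deriv p (sinhP p y) hp) (arcInt_pos p _).ne'
    (by filter_upwards [Ioi_mem_nhds hy] with z hz using (sinhP_spec p z hp (le_of_lt hz)).2)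
  refine this.congr_deriv ?_
  unfold arcInt
  rw [abs_of_pos hpos, Real.rpow_neg (by positivity), inv_inv]

theorem cothP_eq (p y : ℝ) (hp : 1 < p) (hy : 0 < y) :
    cothP p y = (1 + sinhP p y ^ (-p)) ^ (1 / p) := by
  have hpos : 0 < sinhP p y := hy.trans_le (sinhP_ge p y hp hy.le)
  have hpp : 0 < p := by linarith
  have h1 : sinhP p y = (sinhP p y ^ p) ^ (1 / p) := by
    rw [← Real.rpow_mul hpos.le, mul_one_div_cancel hpp.ne', Real.rpow_one]
  unfold cothP coshP
  conv_lhs => rw [div_eq_mul_inv]; arg 2; rw [h1]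
  rw [← div_eq_mul_inv, ← Real.div_rpow (by positivity) (by positivity), Real.rpow_neg hpos.le]
  congr 1
  field_simp
  ring

noncomputable def wP (p K x : ℝ) : ℝ := K ^ (p - 1) * (cothP p (K * x)) ^ (p - 1)

theorem cothP_pos (p y : ℝ) (hp : 1 < p) (hy : 0 < y) : 0 < cothP p y := by
  have hpos : 0 < sinhP p y := hy.trans_le (sinhP_ge p y hp hy.le)
  rw [cothP_eq p y hp hy]; positivity

theorem wP_pos (p K x : ℝ) (hp : 1 < p) (hK : 0 < K) (hx : 0 < x) : 0 < wP p K x := by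
  have := cothP_pos p (K * x) hp (by positivity)
  unfold wP; positivity

theorem wP_pow (p K x : ℝ) (hp : 1 < p) (hK : 0 < K) (hx : 0 < x) :
    wP p K x ^ (p / (p - 1)) = K ^ p * (1 + sinhP p (K * x) ^ (-p)) := by
  have hy : 0 < K * x := by positivity
  have hc := cothP_pos p (K * x) hp hy
  have hpos : 0 < sinhP p (K * x) := hy.trans_le (sinhP_ge p _ hp hy.le)
  have hpp : 0 < p := by linarith
  have hp1 : 0 < p - 1 := by linarith
  unfold wP
  rw [Real.mul_rpow (by positivity) (by positivity), ← Real.rpow_mul hK.le, ← Real.rpow_mul hc.le,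
    mul_div_cancel₀ _ hp1.ne', cothP_eq p _ hp hy, ← Real.rpow_mul (by positivity),
    one_div_mul_cancel hpp.ne', Real.rpow_one]

theorem wP_deriv (p K x : ℝ) (hp : 1 < p) (hK : 0 < K) (hx : 0 < x) :
    HasDerivAt (wP p K) ((p - 1) * K ^ p - (p - 1) * wP p K x ^ (p / (p - 1))) x := by
  have hy : 0 < K * x := by positivity
  have hpos : 0 < sinhP p (K * x) := hy.trans_le (sinhP_ge p _ hp hy.le)
  have hpp : 0 < p := by linarith
  have hp1 : 0 < p - 1 := by linarith
  rw [wP_pow p K x hp hK hx]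
  have hloc : wP p K =ᶠ[nhds x]
      fun z => K ^ (p - 1) * (1 + sinhP p (K * z) ^ (-p)) ^ ((p - 1) / p) := by
    filter_upwards [Ioi_mem_nhds hx] with z hz
    have hz' : 0 < K * z := mul_pos hK hz
    have hposz : 0 < sinhP p (K * z) := hz'.trans_le (sinhP_ge p _ hp hz'.le)
    unfold wP
    rw [cothP_eq p _ hp hz', ← Real.rpow_mul (by positivity)]
    congr 2; ring
  refine HasDerivAt.congr_of_eventuallyEq ?_ hloc
  have h1 : HasDerivAt (fun z => K * z) K x := by simpa using (hasDerivAt_id x).const_mul K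
  have h2 : HasDerivAt (fun z => sinhP p (K * z)) _ x := (sinhP_deriv p _ hp hy).comp x h1
  have hb : 0 < 1 + sinhP p (K * x) ^ (-p) := by positivity
  have h3 := ((((h2.rpow_const (p := -p) (Or.inl hpos.ne')).const_add 1).rpow_const
    (p := (p - 1) / p) (Or.inl hb.ne')).const_mul (K ^ (p - 1)))
  refine h3.congr_deriv ?_
  set s := sinhP p (K * x) with hs
  have e1 : (1 + s ^ p) ^ (1 / p) = s * (1 + s ^ (-p)) ^ (1 / p) := by
    have : 1 + s ^ p = s ^ p * (1 + s ^ (-p)) := by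
      rw [mul_add, ← Real.rpow_add hpos]; simp [add_comm]
    rw [this, Real.mul_rpow (by positivity) hb.le, ← Real.rpow_mul hpos.le,
      mul_one_div_cancel hpp.ne', Real.rpow_one]
  have e2 : (1 + s ^ (-p)) ^ ((p - 1) / p - 1) = ((1 + s ^ (-p)) ^ (1 / p))⁻¹ := by
    rw [← Real.rpow_neg hb.le]; congr 1; field_simp; ring
  have e3 : s ^ (-p - 1) = s ^ (-p) * s⁻¹ := by
    rw [Real.rpow_sub_one hpos.ne']; rfl
  have e4 : K ^ p = K ^ (p - 1) * K := by
    rw [← Real.rpow_add_one hK.ne']; congr 1; ring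
  have hne : (1 + s ^ (-p)) ^ (1 / p) ≠ 0 := by positivity
  rw [e1, e2, e3, e4]
  generalize (1 + s ^ (-p)) ^ (1 / p) = A at hne
  generalize s ^ (-p) = B
  field_simp
  ring

theorem wP_bound (p K c x : ℝ) (hp : 1 < p) (hK : 0 < K) (hx : 0 < x) (hxc : x ≤ c) :
    wP p K x * x ^ (p - 1) ≤ (K * c + 1) ^ (p - 1) := by
  have hy : 0 < K * x := by positivity
  have hge := sinhP_ge p _ hp hy.le
  have hpos : 0 < sinhP p (K * x) := hy.trans_le hge
  have hc := cothP_pos p (K * x) hp hy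
  have hpp : 0 < p := by linarith
  have hp1 : 0 < p - 1 := by linarith
  unfold wP
  rw [mul_right_comm, ← Real.mul_rpow hK.le hx.le, ← Real.mul_rpow hy.le hc.le]
  apply Real.rpow_le_rpow (by positivity) _ hp1.le
  have h1 : coshP p (K * x) ≤ 1 + sinhP p (K * x) := by
    unfold coshP
    have h := Real.add_rpow_le_rpow_add zero_le_one hpos.le hp.le
    rw [Real.one_rpow] at h
    calc (1 + sinhP p (K * x) ^ p) ^ (1 / p) ≤ ((1 + sinhP p (K * x)) ^ p) ^ (1 / p) := by gcongr
      _ = 1 + sinhP p (K * x) := by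
        rw [← Real.rpow_mul (by positivity), mul_one_div_cancel hpp.ne', Real.rpow_one]
  unfold cothP
  rw [mul_div_assoc', div_le_iff₀ hpos]
  have h2 : K * x ≤ K * c := by gcongr
  nlinarith [mul_le_mul_of_nonneg_left h1 hy.le, mul_le_mul_of_nonneg_right h2 hpos.le]

theorem wP_convex (p K : ℝ) (hp : 1 < p) (hK : 0 < K) : ConvexOn ℝ (Set.Ioi 0) (wP p K) := by
  have hp1 : 0 < p - 1 := by linarith
  have hd : ∀ x ∈ Set.Ioi (0:ℝ), HasDerivAt (wP p K) _ x := fun x hx => wP_deriv p K x hp hK hx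
  have hcont : ContinuousOn (wP p K) (Set.Ioi 0) :=
    fun x hx => (hd x hx).continuousAt.continuousWithinAt
  have hanti : AntitoneOn (wP p K) (Set.Ioi 0) := by
    refine antitoneOn_of_deriv_nonpos (convex_Ioi 0) hcont ?_ ?_
    · rw [interior_Ioi]; exact fun x hx => (hd x hx).differentiableAt.differentiableWithinAt
    · rw [interior_Ioi]; intro x hx
      have hx' : 0 < x := hx
      rw [(hd x hx).deriv, wP_pow p K x hp hK hx]
      have hy : 0 < K * x := by positivity
      have hpos : 0 < sinhP p (K * x) := hy.trans_le (sinhP_ge p _ hp hy.le)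
      have : 0 ≤ (p - 1) * K ^ p * sinhP p (K * x) ^ (-p) := by positivity
      linarith
  refine MonotoneOn.convexOn_of_deriv (convex_Ioi 0) hcont ?_ ?_
  · rw [interior_Ioi]; exact fun x hx => (hd x hx).differentiableAt.differentiableWithinAt
  · rw [interior_Ioi]; intro x hx y hy hxy
    rw [(hd x hx).deriv, (hd y hy).deriv]
    have h1 := hanti hx hy hxy
    have h2 : wP p K y ^ (p / (p - 1)) ≤ wP p K x ^ (p / (p - 1)) :=
      Real.rpow_le_rpow (wP_pos p K y hp hK hy).le h1 (by positivity)
    nlinarith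

/-- Lyapunov-type inequality for `λ < 0`: if the BVP
`(|u'|^(p-2)u')' + (λ + r)|u|^(p-2)u = 0`, `u(0) = u(π_p) = 0` has a nontrivial solution,
then `∫₀^{π_p} r₊ > 2 K^(p-1) (coth_p (K π_p / 2))^(p-1)` where `K = (-λ/(p-1))^(1/p)`. -/
theorem lyapunov_neg_lambda (p lam K : ℝ) (hp : 1 < p) (hlam : lam < 0)
    (hK : K = (-lam / (p - 1)) ^ (1 / p))
    (r u u' : ℝ → ℝ) (hr : ContinuousOn r (Set.Icc 0 (piP p)))
    (hsol : IsNontrivialSolution p lam r u u') :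
    (∫ x in (0:ℝ)..piP p, max (r x) 0) >
      2 * K ^ (p - 1) * (cothP p (K * piP p / 2)) ^ (p - 1) := by
  have hpp : 0 < p := by linarith
  have hp1 : 0 < p - 1 := by linarith
  have hquot : 0 < -lam / (p - 1) := div_pos (by linarith) hp1
  have hK0 : 0 < K := by rw [hK]; positivity
  have hKp : (p - 1) * K ^ p = -lam := by
    rw [hK, ← Real.rpow_mul hquot.le, one_div_mul_cancel hpp.ne', Real.rpow_one]
    field_simp
  obtain ⟨⟨x0, hx0, hux0⟩, hu'c, hu, hu0, huL, heq⟩ := hsol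
  generalize piP p = L at *
  have hL : 0 ≤ L := hx0.1.trans hx0.2
  have hucont : ContinuousOn u (Set.Icc 0 L) := fun x hx => (hu x hx).continuousWithinAt
  obtain ⟨c, hc, hcmax⟩ := isCompact_Icc.exists_isMaxOn ⟨x0, hx0⟩ hucont.abs
  have hmax : ∀ x ∈ Set.Icc 0 L, |u x| ≤ |u c| := fun x hx => hcmax hx
  have huc : u c ≠ 0 := abs_pos.mp ((abs_pos.mpr hux0).trans_le (hmax x0 hx0))
  have hc0 : 0 < c := lt_of_le_of_ne hc.1 (fun h => huc (h ▸ hu0))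
  have hcL : c < L := lt_of_le_of_ne hc.2 (fun h => huc (h ▸ huL))
  have hu'0 : u' c = 0 := by
    have h1 : HasDerivAt u (u' c) c := (hu c hc).hasDerivAt (Icc_mem_nhds hc0 hcL)
    have h2 : IsLocalMax (fun x => u x * u x) c := by
      filter_upwards [Icc_mem_nhds hc0 hcL] with x hx
      exact abs_le_iff_mul_self_le.mp (hmax x hx)
    have h3 := h2.hasDerivAt_eq_zero (h1.mul h1)
    have h4 : u c * u' c = 0 := by linarith
    exact (mul_eq_zero.mp h4).resolve_left huc
  let cl : ℝ → ℝ := fun x => max 0 (min x L)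
  have hclm : ∀ x, cl x ∈ Set.Icc 0 L := fun x => ⟨le_max_left _ _, max_le hL (min_le_right _ _)⟩
  have hcle : ∀ x ∈ Set.Icc 0 L, cl x = x := fun x hx => by
    simp only [cl]; rw [min_eq_left hx.2, max_eq_right hx.1]
  let rho : ℝ → ℝ := fun x => max (r (cl x)) 0
  have hrho : Continuous rho := by
    have h1 : Continuous cl := by fun_prop
    exact (hr.comp_continuous h1 hclm).max continuous_const
  have hrho0 : ∀ x, 0 ≤ rho x := fun x => le_max_right _ _
  have hrrho : ∀ x ∈ Set.Icc 0 L, r x ≤ rho x := fun x hx => by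
    simp only [rho]; rw [hcle x hx]; exact le_max_left _ _
  have hint : ∫ x in (0:ℝ)..L, max (r x) 0 = ∫ x in (0:ℝ)..L, rho x := by
    apply intervalIntegral.integral_congr
    intro x hx
    rw [Set.uIcc_of_le hL] at hx
    simp only [rho]; rw [hcle x hx]
  have hwd : ∀ x, 0 < x → HasDerivAt (wP p K) (-lam - (p - 1) * wP p K x ^ (p / (p - 1))) x := by
    intro x hx; rw [← hKp]; exact wP_deriv p K x hp hK0 hx
  have hsub1 : Set.Icc 0 c ⊆ Set.Icc 0 L := Set.Icc_subset_Icc_right hcL.le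
  have hA := half_ineq p (-lam) c hp hc0 (wP p K) r rho u u'
    (fun x hx => wP_pos p K x hp hK0 hx) hwd _ (fun x hx hxc => wP_bound p K c x hp hK0 hx hxc)
    hrho hrho0 (fun x hx => hrrho x ⟨hx.1.le, hx.2.le.trans hcL.le⟩)
    (hu'c.mono hsub1) (fun x hx => (hu x (hsub1 hx)).mono hsub1) hu0 huc hu'0
    (fun x hx => hmax x (hsub1 hx))
    (fun x hx => by rw [neg_neg]; exact heq x ⟨hx.1, hx.2.trans hcL⟩)
  have hmaps : Set.MapsTo (fun x => L - x) (Set.Icc 0 (L - c)) (Set.Icc 0 L) := by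
    intro x hx
    constructor <;> [have := hx.2; have := hx.1] <;> simp only <;> linarith
  have hB := half_ineq p (-lam) (L - c) hp (by linarith) (wP p K) (fun x => r (L - x))
    (fun x => rho (L - x)) (fun x => u (L - x)) (fun x => - u' (L - x))
    (fun x hx => wP_pos p K x hp hK0 hx) hwd _
    (fun x hx hxc => wP_bound p K (L - c) x hp hK0 hx hxc)
    (hrho.comp (by fun_prop)) (fun x => hrho0 _)
    (fun x hx => hrrho _ (hmaps ⟨hx.1.le, hx.2.le⟩))
    ((hu'c.comp (by fun_prop) hmaps).neg)
    (fun x hx => by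
      have h1 : HasDerivWithinAt (fun x => L - x) (-1) (Set.Icc 0 (L - c)) x :=
        ((hasDerivAt_id x).const_sub L).hasDerivWithinAt
      have := (hu (L - x) (hmaps hx)).comp x h1 hmaps
      simpa [Function.comp_def] using this)
    (by simpa using huL) (by simpa using huc) (by simpa using hu'0)
    (fun x hx => by simpa using hmax _ (hmaps hx))
    (fun x hx => by
      have h1 : HasDerivAt (fun x => L - x) (-1) x := (hasDerivAt_id x).const_sub L
      have hx' : L - x ∈ Set.Ioo 0 L := ⟨by linarith [hx.2], by linarith [hx.1]⟩
      have := ((heq (L - x) hx').comp x h1).neg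
      rw [neg_neg]
      simp only [Function.comp_def, mul_neg, mul_one, neg_neg] at this
      simp only [abs_neg, mul_neg]
      exact this)
  rw [intervalIntegral.integral_comp_sub_left (fun x => rho x) L] at hB
  simp only [sub_sub_cancel, sub_zero] at hB
  have hadd := intervalIntegral.integral_add_adjacent_intervals (hrho.intervalIntegrable (μ := MeasureTheory.volume) 0 c)
    (hrho.intervalIntegrable (μ := MeasureTheory.volume) c L)
  have hconv := (wP_convex p K hp hK0).2 (show c ∈ Set.Ioi (0:ℝ) from hc0)
    (show L - c ∈ Set.Ioi (0:ℝ) from sub_pos.2 hcL) (show (0:ℝ) ≤ 1 / 2 by norm_num)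
    (show (0:ℝ) ≤ 1 / 2 by norm_num) (by norm_num)
  simp only [smul_eq_mul] at hconv
  have hmid : 1 / 2 * c + 1 / 2 * (L - c) = L / 2 := by ring
  rw [hmid] at hconv
  have hw : wP p K (L / 2) = K ^ (p - 1) * (cothP p (K * L / 2)) ^ (p - 1) := by
    unfold wP; rw [mul_div_assoc]
  rw [hint, gt_iff_lt, mul_assoc, ← hw]
  linarith
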